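/- Let Ω ⊂ ℝ^d be a bounded open convex set with boundary Γ, and let T > 0. Let c, c̃ : ℝ^d → ℝ be positive C² functions such that the supports of c − 1 and of c̃ − 1 are compact subsets of Ω. For each (x₀, ξ₀) with x₀ ∈ Γ, |ξ₀| = 1, define (x(t), ξ(t)) (respectively (x̃(t), ξ̃(t))) to be the solution of ẋ = c(x)² ξ, ξ̇ = −(1/2) ∇(c²)(x) |ξ|² (respectively with c̃ in place of c) with initial data (x₀, ξ₀) at t = 0. Let S₋*Γ denote the set of such (x₀, ξ₀) for which additionally the trajectory enters Ω, i.e. x(t) ∈ Ω for small t > 0 (and likewise for x̃), and assume that for every (x₀, ξ₀) ∈ S₋*Γ the exit times l(x₀, ξ₀) := inf{ t > 0 : x(t) ∉ Ω } and l̃(x₀, ξ₀) := inf{ t > 0 : x̃(t) ∉ Ω } are finite and at most T. Then the following are equivalent: (i) for every (x₀, ξ₀) ∈ S₋*Γ, l(x₀, ξ₀) = l̃(x₀, ξ₀) and ( x(l(x₀,ξ₀)), ξ(l(x₀,ξ₀)) ) = ( x̃(l̃(x₀,ξ₀)), ξ̃(l̃(x₀,ξ₀)) ); (ii) for every (x₀,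 ξ₀) ∈ S₋*Γ, ( x(T), ξ(T) ) = ( x̃(T), ξ̃(T) ). -/

import Mathlib

section helpers
variable {d : ℕ}

/-- The trajectory is straight as long as it avoids the support of `c - 1`. -/
lemma straight_aux (c : EuclideanSpace ℝ (Fin d) → ℝ)
    (x ξ : ℝ → EuclideanSpace ℝ (Fin d))
    (hode : ∀ t : ℝ, HasDerivAt x ((c (x t)) ^ 2 • ξ t) t ∧
      HasDerivAt ξ ((-(1 / 2 : ℝ) * ‖ξ t‖ ^ 2) • gradient (fun y => (c y) ^ 2) (x t)) t)
    (a b : ℝ) (hab : ∀ t ∈ Set.Icc a b, x t ∉ tsupport (fun y => c y - 1)) :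
    ∀ t ∈ Set.Icc a b, ξ t = ξ a ∧ x t = x a + (t - a) • ξ a := by
  have hξ : ∀ t ∈ Set.Icc a b, ξ t = ξ a := by
    apply constant_of_has_deriv_right_zero
    · exact fun t _ => (hode t).2.continuousAt.continuousWithinAt
    · intro t ht
      have h := (hode t).2
      have hn := hab t ⟨ht.1, ht.2.le⟩
      rw [notMem_tsupport_iff_eventuallyEq] at hn
      have he : (fun y => (c y) ^ 2) =ᶠ[nhds (x t)] fun _ => (1 : ℝ) := by
        filter_upwards [hn] with y hy
        have : c y - 1 = 0 := hy
        have : c y = 1 := by linarith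
        simp [this]
      have hg : gradient (fun y => (c y) ^ 2) (x t) = 0 := by
        rw [gradient, he.fderiv_eq]; simp
      rw [hg, smul_zero] at h
      exact h.hasDerivWithinAt
  have hx : ∀ t ∈ Set.Icc a b, x t - (t - a) • ξ a = x a - (a - a) • ξ a := by
    have hd : ∀ t, HasDerivAt (fun t => x t - (t - a) • ξ a)
        ((c (x t)) ^ 2 • ξ t - (1 : ℝ) • ξ a) t := fun t =>
      (hode t).1.sub (((hasDerivAt_id t).sub_const a).smul_const (ξ a))
    apply constant_of_has_deriv_right_zero (f := fun t => x t - (t - a) • ξ a)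
    · exact fun t _ => (hd t).continuousAt.continuousWithinAt
    · intro t ht
      have h := hd t
      have ht' : t ∈ Set.Icc a b := ⟨ht.1, ht.2.le⟩
      have hn := image_eq_zero_of_notMem_tsupport (hab t ht')
      have : c (x t) = 1 := by linarith
      rw [hξ t ht', this, one_pow, sub_self] at h
      exact h.hasDerivWithinAt
  intro t ht
  refine ⟨hξ t ht, ?_⟩
  have := hx t ht
  rw [sub_self, zero_smul, sub_zero] at this
  rw [← this]; abel

/-- Behaviour of one trajectory around and after its exit time. -/
lemma exit_aux (Ω : Set (EuclideanSpace ℝ (Fin d)))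
    (hΩopen : IsOpen Ω) (hΩconv : Convex ℝ Ω)
    (c : EuclideanSpace ℝ (Fin d) → ℝ)
    (hsuppΩ : tsupport (fun y => c y - 1) ⊆ Ω)
    (x ξ : ℝ → EuclideanSpace ℝ (Fin d))
    (hode : ∀ t : ℝ, HasDerivAt x ((c (x t)) ^ 2 • ξ t) t ∧
      HasDerivAt ξ ((-(1 / 2 : ℝ) * ‖ξ t‖ ^ 2) • gradient (fun y => (c y) ^ 2) (x t)) t)
    (hin : ∃ ε > 0, ∀ t ∈ Set.Ioo (0 : ℝ) ε, x t ∈ Ω)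
    (l : ℝ) (hl : l = sInf {t : ℝ | 0 < t ∧ x t ∉ Ω})
    (hne : {t : ℝ | 0 < t ∧ x t ∉ Ω}.Nonempty) :
    ∃ a < l, (∀ t ∈ Set.Ico a l, x t ∈ Ω) ∧ (∀ t, l ≤ t → x t ∉ Ω) ∧
      ∀ t, a ≤ t → ξ t = ξ a ∧ x t = x a + (t - a) • ξ a := by
  have hxc : Continuous x := continuous_iff_continuousAt.2 fun t => (hode t).1.continuousAt
  have hbdd : BddBelow {t : ℝ | 0 < t ∧ x t ∉ Ω} := ⟨0, fun t ht => ht.1.le⟩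
  obtain ⟨ε, hε, hin⟩ := hin
  have hlpos : 0 < l := by
    refine lt_of_lt_of_le hε ?_
    rw [hl]
    refine le_csInf hne fun t ht => ?_
    by_contra hlt
    exact ht.2 (hin t ⟨ht.1, not_le.1 hlt⟩)
  have hbefore : ∀ t, 0 < t → t < l → x t ∈ Ω := by
    intro t h0 h1
    by_contra hc
    rw [hl] at h1
    exact notMem_of_lt_csInf h1 hbdd ⟨h0, hc⟩
  have hclosed : IsClosed {t : ℝ | x t ∉ Ω} := (hΩopen.preimage hxc).isClosed_compl
  have hxl : x l ∉ Ω := by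
    have h1 := csInf_mem_closure hne hbdd
    rw [← hl] at h1
    exact closure_minimal (fun t ht => ht.2) hclosed h1
  -- openness
  have hUo : IsOpen {t : ℝ | x t ∉ tsupport (fun y => c y - 1)} :=
    ((isClosed_tsupport _).preimage hxc).isOpen_compl
  have hloc : ∀ m, x m ∉ Ω → ∃ δ > 0, ∀ t, |t - m| < δ →
      x t ∉ tsupport (fun y => c y - 1) := by
    intro m hm
    obtain ⟨δ, hδ, h⟩ := Metric.isOpen_iff.1 hUo m (fun h => hm (hsuppΩ h))
    exact ⟨δ, hδ, fun t ht => h (by simpa [Real.dist_eq] using ht)⟩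
  obtain ⟨δ, hδ, hd⟩ := hloc l hxl
  set a := max (l - δ / 2) (l / 2) with ha
  have hal : a < l := max_lt (by linarith) (by linarith)
  have ha1 : l - δ / 2 ≤ a := le_max_left _ _
  have ha2 : l / 2 ≤ a := le_max_right _ _
  have hA : ∀ t ∈ Set.Icc a l, x t ∉ tsupport (fun y => c y - 1) := by
    intro t ht
    apply hd
    rw [abs_lt]
    constructor <;> linarith [ht.1, ht.2]
  have hafter : ∀ t, l ≤ t → x t ∉ Ω := by
    by_contra! hcon
    obtain ⟨t1, ht1, hx1⟩ := hcon
    set B := {t : ℝ | l ≤ t ∧ x t ∈ Ω} with hB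
    have hBne : B.Nonempty := ⟨t1, ht1, hx1⟩
    have hBb : BddBelow B := ⟨l, fun t ht => ht.1⟩
    have hlm : l ≤ sInf B := le_csInf hBne fun t ht => ht.1
    have hm1 : ∀ t, l ≤ t → t < sInf B → x t ∉ Ω := fun t h1 h2 h3 =>
      notMem_of_lt_csInf h2 hBb ⟨h1, h3⟩
    have hxm : x (sInf B) ∉ Ω := by
      rcases hlm.eq_or_lt with h | h
      · rw [← h]; exact hxl
      · have : sInf B ∈ closure (Set.Ico l (sInf B)) := by
          rw [closure_Ico h.ne]; exact ⟨hlm, le_rfl⟩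
        exact closure_minimal (fun t ht => hm1 t ht.1 ht.2) hclosed this
    obtain ⟨δ', hδ', hd'⟩ := hloc _ hxm
    obtain ⟨s, hsB, hs⟩ := exists_lt_of_csInf_lt hBne (show sInf B < sInf B + δ' by linarith)
    have hms : sInf B ≤ s := csInf_le hBb hsB
    have hall : ∀ t ∈ Set.Icc a s, x t ∉ tsupport (fun y => c y - 1) := by
      intro t ht
      rcases le_total t l with h | h
      · exact hA t ⟨ht.1, h⟩
      · rcases lt_or_ge t (sInf B) with h2 | h2
        · exact fun h3 => hm1 t h h2 (hsuppΩ h3)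
        · apply hd'
          rw [abs_lt]
          constructor <;> linarith [ht.2]
    have hst := straight_aux c x ξ hode a s hall
    have hls : l ≤ s := hsB.1
    have e1 := (hst l ⟨hal.le, hls⟩).2
    have e2 := (hst s ⟨hal.le.trans hls, le_rfl⟩).2
    have hpos : 0 < s - a := by linarith
    apply hxl
    have := hΩconv.add_smul_sub_mem (hbefore a (by linarith) hal) hsB.2
      (t := (l - a) / (s - a)) ⟨by apply div_nonneg <;> linarith, by
        rw [div_le_one hpos]; linarith⟩
    rw [e2, add_sub_cancel_left, smul_smul, div_mul_cancel₀ _ hpos.ne', ← e1] at this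
    exact this
  refine ⟨a, hal, fun t ht => hbefore t (by linarith [ht.1]) ht.2, hafter, fun t ht => ?_⟩
  refine straight_aux c x ξ hode a t (fun s hs => ?_) t ⟨ht, le_rfl⟩
  rcases le_total s l with h | h
  · exact hA s ⟨hs.1, h⟩
  · exact fun h3 => hafter s h (hsuppΩ h3)

lemma exit_le_aux (Ω : Set (EuclideanSpace ℝ (Fin d)))
    (x ξ x' ξ' : ℝ → EuclideanSpace ℝ (Fin d)) (l l' T : ℝ) (hT : l ≤ T) (hT' : l' ≤ T)
    (h1 : ∃ a < l, (∀ t ∈ Set.Ico a l, x t ∈ Ω) ∧ (∀ t, l ≤ t → x t ∉ Ω) ∧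
      ∀ t, a ≤ t → ξ t = ξ a ∧ x t = x a + (t - a) • ξ a)
    (h2 : ∃ a < l', (∀ t ∈ Set.Ico a l', x' t ∈ Ω) ∧ (∀ t, l' ≤ t → x' t ∉ Ω) ∧
      ∀ t, a ≤ t → ξ' t = ξ' a ∧ x' t = x' a + (t - a) • ξ' a)
    (hx : x T = x' T) (hξ : ξ T = ξ' T) : l' ≤ l := by
  by_contra! hlt
  obtain ⟨a, ha, -, h1o, h1s⟩ := h1
  obtain ⟨b, hb, h2i, -, h2s⟩ := h2
  have hm1 : l ≤ max l b := le_max_left _ _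
  have hm2 : b ≤ max l b := le_max_right _ _
  have hm3 : max l b < l' := max_lt hlt hb
  apply h1o _ hm1
  have e : x (max l b) = x' (max l b) := by
    have e1 := h1s T (by linarith)
    have e2 := h2s T (by linarith)
    have e3 := h1s (max l b) (by linarith)
    have e4 := h2s (max l b) hm2
    rw [e1.2, e2.2] at hx
    rw [e1.1, e2.1] at hξ
    rw [e3.2, e4.2]
    rw [hξ] at hx ⊢
    linear_combination (norm := module) hx
  rw [e]
  exact h2i _ ⟨hm2, hm3⟩

end helpers

/-- Equivalence of the scattering relation and the time-`T` Hamiltonian flow on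
incoming boundary unit covectors, for two velocity fields `c`, `c'` equal to `1`
near the boundary of a bounded open convex domain `Ω`.

`X x₀ ξ₀` and `Ξ x₀ ξ₀` (resp. `X'`, `Ξ'`) denote the solution of Hamilton's
equations `ẋ = c(x)²ξ`, `ξ̇ = −(1/2)∇(c²)(x)|ξ|²` for `c` (resp. `c'`) with
initial data `(x₀, ξ₀)`; `S` is the set of incoming boundary unit covectors (for
both flows), and `l`, `l'` are the exit times, assumed finite and at most `T`.
Then the two scattering relations (exit times, exit points and exit covectors)
agree on `S` if and only if the two flows at time `T` agree on `S`. -/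
theorem stmt14 {d : ℕ}
    (Ω : Set (EuclideanSpace ℝ (Fin d)))
    (hΩopen : IsOpen Ω) (hΩconv : Convex ℝ Ω) (hΩbdd : Bornology.IsBounded Ω)
    (T : ℝ) (hT : 0 < T)
    (c c' : EuclideanSpace ℝ (Fin d) → ℝ)
    (hcpos : ∀ y, 0 < c y) (hc'pos : ∀ y, 0 < c' y)
    (hc : ContDiff ℝ 2 c) (hc' : ContDiff ℝ 2 c')
    (hsupp : IsCompact (tsupport fun y => c y - 1))
    (hsuppΩ : tsupport (fun y => c y - 1) ⊆ Ω)
    (hsupp' : IsCompact (tsupport fun y => c' y - 1))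
    (hsupp'Ω : tsupport (fun y => c' y - 1) ⊆ Ω)
    (X Ξ X' Ξ' : EuclideanSpace ℝ (Fin d) → EuclideanSpace ℝ (Fin d) →
      ℝ → EuclideanSpace ℝ (Fin d))
    (hinit : ∀ x₀ ξ₀, x₀ ∈ frontier Ω → ‖ξ₀‖ = 1 →
      X x₀ ξ₀ 0 = x₀ ∧ Ξ x₀ ξ₀ 0 = ξ₀ ∧ X' x₀ ξ₀ 0 = x₀ ∧ Ξ' x₀ ξ₀ 0 = ξ₀)
    (hode : ∀ x₀ ξ₀, x₀ ∈ frontier Ω → ‖ξ₀‖ = 1 → ∀ t : ℝ,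
      HasDerivAt (X x₀ ξ₀) ((c (X x₀ ξ₀ t)) ^ 2 • Ξ x₀ ξ₀ t) t ∧
      HasDerivAt (Ξ x₀ ξ₀)
        ((-(1 / 2 : ℝ) * ‖Ξ x₀ ξ₀ t‖ ^ 2) •
          gradient (fun y => (c y) ^ 2) (X x₀ ξ₀ t)) t)
    (hode' : ∀ x₀ ξ₀, x₀ ∈ frontier Ω → ‖ξ₀‖ = 1 → ∀ t : ℝ,
      HasDerivAt (X' x₀ ξ₀) ((c' (X' x₀ ξ₀ t)) ^ 2 • Ξ' x₀ ξ₀ t) t ∧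
      HasDerivAt (Ξ' x₀ ξ₀)
        ((-(1 / 2 : ℝ) * ‖Ξ' x₀ ξ₀ t‖ ^ 2) •
          gradient (fun y => (c' y) ^ 2) (X' x₀ ξ₀ t)) t)
    (S : Set (EuclideanSpace ℝ (Fin d) × EuclideanSpace ℝ (Fin d)))
    (hS : S = {p | p.1 ∈ frontier Ω ∧ ‖p.2‖ = 1 ∧
      (∃ ε > 0, ∀ t ∈ Set.Ioo (0 : ℝ) ε, X p.1 p.2 t ∈ Ω) ∧
      (∃ ε > 0, ∀ t ∈ Set.Ioo (0 : ℝ) ε, X' p.1 p.2 t ∈ Ω)})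
    (l l' : EuclideanSpace ℝ (Fin d) → EuclideanSpace ℝ (Fin d) → ℝ)
    (hl : ∀ x₀ ξ₀, l x₀ ξ₀ = sInf {t : ℝ | 0 < t ∧ X x₀ ξ₀ t ∉ Ω})
    (hl' : ∀ x₀ ξ₀, l' x₀ ξ₀ = sInf {t : ℝ | 0 < t ∧ X' x₀ ξ₀ t ∉ Ω})
    (hexit : ∀ p ∈ S, {t : ℝ | 0 < t ∧ X p.1 p.2 t ∉ Ω}.Nonempty ∧ l p.1 p.2 ≤ T)
    (hexit' : ∀ p ∈ S,
      {t : ℝ | 0 < t ∧ X' p.1 p.2 t ∉ Ω}.Nonempty ∧ l' p.1 p.2 ≤ T) :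
    (∀ p ∈ S, l p.1 p.2 = l' p.1 p.2 ∧
        X p.1 p.2 (l p.1 p.2) = X' p.1 p.2 (l' p.1 p.2) ∧
        Ξ p.1 p.2 (l p.1 p.2) = Ξ' p.1 p.2 (l' p.1 p.2)) ↔
      (∀ p ∈ S, X p.1 p.2 T = X' p.1 p.2 T ∧ Ξ p.1 p.2 T = Ξ' p.1 p.2 T) := by
  have key : ∀ p ∈ S, _ ∧ _ := fun p hp => by
    have hp' := hp
    rw [hS] at hp'
    obtain ⟨hf, hn, hi, hi'⟩ := hp'
    exact And.intro
      (exit_aux Ω hΩopen hΩconv c hsuppΩ (X p.1 p.2) (Ξ p.1 p.2) (hode _ _ hf hn) hi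
        (l p.1 p.2) (hl _ _) (hexit p hp).1)
      (exit_aux Ω hΩopen hΩconv c' hsupp'Ω (X' p.1 p.2) (Ξ' p.1 p.2) (hode' _ _ hf hn) hi'
        (l' p.1 p.2) (hl' _ _) (hexit' p hp).1)
  constructor
  · intro h p hp
    obtain ⟨h1, h2, h3⟩ := h p hp
    obtain ⟨⟨a, ha, -, -, hs⟩, ⟨b, hb, -, -, hs'⟩⟩ := key p hp
    have hT1 := (hexit p hp).2
    have hT2 := (hexit' p hp).2
    have e1 := hs T (by linarith)
    have e2 := hs' T (by linarith)
    have e3 := hs (l p.1 p.2) ha.le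
    have e4 := hs' (l' p.1 p.2) hb.le
    rw [e3.1, e4.1] at h3
    rw [e3.2, e4.2, h1, h3] at h2
    rw [e1.1, e2.1, e1.2, e2.2, h3]
    refine ⟨?_, rfl⟩
    linear_combination (norm := module) h2
  · intro h p hp
    obtain ⟨h1, h2⟩ := h p hp
    obtain ⟨k1, k2⟩ := key p hp
    have hT1 := (hexit p hp).2
    have hT2 := (hexit' p hp).2
    have hll : l p.1 p.2 = l' p.1 p.2 := le_antisymm
      (exit_le_aux Ω _ _ _ _ _ _ T hT2 hT1 k2 k1 h1.symm h2.symm)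
      (exit_le_aux Ω _ _ _ _ _ _ T hT1 hT2 k1 k2 h1 h2)
    refine ⟨hll, ?_⟩
    obtain ⟨a, ha, -, -, hs⟩ := k1
    obtain ⟨b, hb, -, -, hs'⟩ := k2
    have e1 := hs T (by linarith)
    have e2 := hs' T (by linarith)
    have e3 := hs (l p.1 p.2) ha.le
    have e4 := hs' (l' p.1 p.2) hb.le
    rw [e1.1, e2.1] at h2
    rw [e1.2, e2.2, h2] at h1
    rw [e3.1, e4.1, e3.2, e4.2, h2, hll]
    refine ⟨?_, rfl⟩
    linear_combination (norm := module) h1
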